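/- Let n ≥ 6 and α > 0. Define u₀(y) = ((n−3)/2) · y/(1−y) + y · ( Σ_{m=1}^∞ m d_m (1−y)^{m−1} ) / G(y) for y ∈ (0,1). Then ∫₀¹ y^{α−1} (1−y)^{(n−3)/2} G(y) · u₀(y)² dy < ∞. -/

import Mathlib

open MeasureTheory Set

/-- The recursively defined coefficients `γ_i(m)` from the paper (depending on `n`). -/
noncomputable def gammaCoeff (n : ℕ) : ℕ → ℕ → ℝ
  | 0, _ => 0
  | 1, m => if m = 0 then 1 else 0
  | (i + 2), m =>
      (Real.Gamma ((m : ℝ) + ((i : ℝ) + 1) * ((i : ℝ) + 2) / (2 * (n : ℝ))) /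
        Real.Gamma ((m : ℝ) + ((i : ℝ) + 2) * ((i : ℝ) + 3) / (2 * (n : ℝ)))) *
      ∑ k ∈ Finset.range (m + 1),
        (Real.Gamma (((m - k : ℕ) : ℝ) + ((i : ℝ) + 2) / (n : ℝ)) /
          (Nat.factorial (m - k) : ℝ)) * gammaCoeff n (i + 1) k

/-- `d_m = γ_{n−1}(m)`. -/
noncomputable def dCoeff (n : ℕ) (m : ℕ) : ℝ := gammaCoeff n (n - 1) m

/-- `G(y) = Σ_{m≥0} d_m (1−y)^m`. -/
noncomputable def Gfun (n : ℕ) (y : ℝ) : ℝ := ∑' m : ℕ, dCoeff n m * (1 - y) ^ m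

/-- Log-convexity of the Gamma function as an exchange inequality. -/
theorem Gamma_add_mul_Gamma_le {x y c : ℝ} (hx : 0 < x) (hxy : x ≤ y) (hc : 0 < c) :
    Real.Gamma (x + c) * Real.Gamma y ≤ Real.Gamma x * Real.Gamma (y + c) := by
  have hy : 0 < y := hx.trans_le hxy
  have hd : 0 < y - x + c := by linarith
  have hl : 0 ≤ c / (y - x + c) := by positivity
  have hl' : 0 ≤ (y - x) / (y - x + c) := div_nonneg (by linarith) hd.le
  have hsum : (y - x) / (y - x + c) + c / (y - x + c) = 1 := by field_simp
  have hyc : 0 < y + c := by linarith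
  have h1 := Real.convexOn_log_Gamma.2 (mem_Ioi.2 hx) (mem_Ioi.2 hyc) hl' hl hsum
  have h2 := Real.convexOn_log_Gamma.2 (mem_Ioi.2 hx) (mem_Ioi.2 hyc) hl hl'
    (by rw [add_comm]; exact hsum)
  have e1 : (y - x) / (y - x + c) * x + c / (y - x + c) * (y + c) = x + c := by
    field_simp; ring
  have e2 : c / (y - x + c) * x + (y - x) / (y - x + c) * (y + c) = y := by
    field_simp; ring
  simp only [smul_eq_mul, Function.comp_apply, e1, e2] at h1 h2
  have hx0 := Real.Gamma_pos_of_pos hx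
  have hy0 := Real.Gamma_pos_of_pos hy
  have hxc0 := Real.Gamma_pos_of_pos (show 0 < x + c by linarith)
  have hyc0 := Real.Gamma_pos_of_pos hyc
  rw [← Real.log_le_log_iff (by positivity) (by positivity), Real.log_mul hxc0.ne' hy0.ne',
    Real.log_mul hx0.ne' hyc0.ne']
  have e : ∀ u v : ℝ, (y - x) / (y - x + c) * u + c / (y - x + c) * v +
      (c / (y - x + c) * u + (y - x) / (y - x + c) * v) = u + v := fun u v ↦ by
    field_simp; ring
  have := e (Real.log (Real.Gamma x)) (Real.log (Real.Gamma (y + c)))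
  linarith

theorem succ_mul_multichoose_succ (b : ℝ) (m : ℕ) :
    ((m : ℝ) + 1) * Ring.multichoose b (m + 1) = (b + m) * Ring.multichoose b m := by
  have h1 := Ring.factorial_nsmul_multichoose_eq_ascPochhammer b (m + 1)
  have h2 := Ring.factorial_nsmul_multichoose_eq_ascPochhammer b m
  rw [Polynomial.ascPochhammer_smeval_eq_eval, nsmul_eq_mul] at h1 h2
  rw [ascPochhammer_succ_eval, ← h2, Nat.factorial_succ] at h1
  have h3 : (m.factorial : ℝ) ≠ 0 := by positivity
  push_cast at h1
  apply mul_left_cancel₀ h3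
  linarith

theorem Gamma_natCast_add_div_factorial {b : ℝ} (hb : 0 < b) (m : ℕ) :
    Real.Gamma ((m : ℝ) + b) / (m.factorial : ℝ) = Real.Gamma b * Ring.multichoose b m := by
  induction m with
  | zero => simp
  | succ m ih =>
    have h : ((m + 1 : ℕ) : ℝ) + b = (m + b) + 1 := by push_cast; ring
    have hm : (0 : ℝ) < m + b := by positivity
    have := succ_mul_multichoose_succ b m
    rw [h, Real.Gamma_add_one hm.ne', Nat.factorial_succ]
    push_cast
    rw [div_eq_iff (by positivity)] at ih ⊢
    rw [ih]
    linear_combination (-Real.Gamma b * m.factorial) * this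

theorem multichoose_pos {b : ℝ} (hb : 0 < b) (m : ℕ) : 0 < Ring.multichoose b m := by
  have h := Gamma_natCast_add_div_factorial hb m
  have h1 : 0 < Real.Gamma ((m : ℝ) + b) / (m.factorial : ℝ) :=
    div_pos (Real.Gamma_pos_of_pos (by positivity)) (by positivity)
  rw [h] at h1
  exact pos_of_mul_pos_right h1 (Real.Gamma_pos_of_pos hb).le

/-- Chu–Vandermonde identity for `Ring.multichoose`. -/
theorem sum_multichoose_mul_multichoose (b c : ℝ) (m : ℕ) :
    ∑ k ∈ Finset.range (m + 1), Ring.multichoose c (m - k) * Ring.multichoose b k =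
      Ring.multichoose (c + b) m := by
  have h := Ring.add_choose_eq m (Commute.all (-b) (-c))
  rw [← neg_add, Finset.Nat.sum_antidiagonal_eq_sum_range_succ_mk] at h
  simp only [Ring.choose_neg, ← Ring.multichoose_eq, Units.smul_def, zsmul_eq_mul] at h
  have h' : ∑ k ∈ Finset.range (m + 1), Ring.multichoose c (m - k) * Ring.multichoose b k =
      (-1) ^ m * ((-1) ^ m * Ring.multichoose (b + c) m) := by
    simp at h
    rw [h, Finset.mul_sum]
    refine Finset.sum_congr rfl fun k hk ↦ ?_
    obtain ⟨j, rfl⟩ := Nat.exists_eq_add_of_le (Finset.mem_range_succ_iff.1 hk)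
    simp only [add_tsub_cancel_left, pow_add]
    have h1 : ((-1 : ℝ) ^ k) * (-1) ^ k = 1 := by rw [← mul_pow]; simp
    have h2 : ((-1 : ℝ) ^ j) * (-1) ^ j = 1 := by rw [← mul_pow]; simp
    linear_combination (-Ring.multichoose c j * Ring.multichoose b k) *
      ((-1 : ℝ) ^ j * (-1) ^ j * h1 + h2)
  rw [h', ← mul_assoc, ← mul_pow, add_comm c b]
  simp

theorem hasSum_multichoose_mul_pow (b : ℝ) {y : ℝ} (hy : y ∈ Ioo (0 : ℝ) 1) :
    HasSum (fun m : ℕ ↦ Ring.multichoose b m * (1 - y) ^ m) (y ^ (-b)) := by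
  have h := (Real.one_div_one_sub_rpow_hasFPowerSeriesOnBall_zero b).hasSum (y := 1 - y) (by
    have : |1 - y| < 1 := abs_lt.2 ⟨by linarith [hy.2], by linarith [hy.1]⟩
    simpa [enorm_eq_nnnorm, ← NNReal.coe_lt_one] using this)
  simpa [FormalMultilinearSeries.ofScalars_apply_eq, Ring.multichoose_eq,
    Real.rpow_neg hy.1.le, mul_comm] using h

theorem gammaCoeff_nonneg {n : ℕ} (hn : 0 < n) (i m : ℕ) : 0 ≤ gammaCoeff n i m := by
  induction i using Nat.strong_induction_on generalizing m with
  | _ i ih =>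
    match i, ih with
    | 0, _ => simp [gammaCoeff]
    | 1, _ => unfold gammaCoeff; split_ifs <;> norm_num
    | (i + 2), ih =>
      unfold gammaCoeff
      have hn' : (0 : ℝ) < n := by exact_mod_cast hn
      refine mul_nonneg (div_nonneg ?_ ?_) (Finset.sum_nonneg fun k _ ↦
        mul_nonneg (div_nonneg ?_ (by positivity)) (ih (i + 1) (by omega) k))
      all_goals exact (Real.Gamma_pos_of_pos (by positivity)).le

theorem gammaCoeff_zero_pos {n : ℕ} (hn : 0 < n) (i : ℕ) : 0 < gammaCoeff n (i + 1) 0 := by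
  induction i with
  | zero => simp [gammaCoeff]
  | succ i ih =>
    have hn' : (0 : ℝ) < n := by exact_mod_cast hn
    unfold gammaCoeff
    simp only [zero_add, Finset.sum_range_one, Nat.factorial_zero, tsub_self]
    refine mul_pos (div_pos ?_ ?_) (mul_pos (div_pos ?_ (by norm_num)) ih)
    all_goals exact Real.Gamma_pos_of_pos (by positivity)

/-- The coefficients are dominated by those of the binomial series of `y ^ (-e)`. -/
theorem exists_gammaCoeff_le {n : ℕ} (hn : 0 < n) {e : ℝ} (he : 0 < e) (hen : e ≤ 1 / n) (i : ℕ) :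
    ∃ C : ℝ, 0 < C ∧ ∀ m, gammaCoeff n (i + 1) m ≤ C * Ring.multichoose e m := by
  have hn' : (0 : ℝ) < n := by exact_mod_cast hn
  induction i with
  | zero =>
    refine ⟨1, one_pos, fun m ↦ ?_⟩
    rcases m with _ | m
    · simp [gammaCoeff]
    · simpa [gammaCoeff] using (multichoose_pos he (m + 1)).le
  | succ i ih =>
    obtain ⟨C, hC, hle⟩ := ih
    set s : ℝ := ((i : ℝ) + 1) * ((i : ℝ) + 2) / (2 * (n : ℝ)) with hs
    set c : ℝ := ((i : ℝ) + 2) / (n : ℝ) with hc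
    have hsc : ((i : ℝ) + 2) * ((i : ℝ) + 3) / (2 * (n : ℝ)) = s + c := by
      rw [hs, hc]; field_simp; ring
    have hs0 : 0 < s := by positivity
    have hc0 : 0 < c := by positivity
    have hes : e ≤ s := by
      refine hen.trans ?_
      rw [hs, div_le_div_iff₀ hn' (by positivity)]
      have : (0 : ℝ) ≤ i := by positivity
      nlinarith [mul_nonneg hn'.le this, mul_nonneg (mul_nonneg hn'.le this) this]
    have hGc := Real.Gamma_pos_of_pos hc0
    have hGe := Real.Gamma_pos_of_pos he
    have hGce := Real.Gamma_pos_of_pos (add_pos hc0 he)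
    refine ⟨C * Real.Gamma c * Real.Gamma e / Real.Gamma (c + e), by positivity, fun m ↦ ?_⟩
    have hms : (0 : ℝ) < m + s := by positivity
    have hGs := Real.Gamma_pos_of_pos hms
    have hGsc := Real.Gamma_pos_of_pos (show (0 : ℝ) < m + (s + c) by positivity)
    have hsum : ∑ k ∈ Finset.range (m + 1),
        (Real.Gamma (((m - k : ℕ) : ℝ) + c) / (Nat.factorial (m - k) : ℝ)) *
          gammaCoeff n (i + 1) k ≤ Real.Gamma c * C * Ring.multichoose (c + e) m := by
      rw [← sum_multichoose_mul_multichoose, Finset.mul_sum]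
      refine Finset.sum_le_sum fun k _ ↦ ?_
      rw [Gamma_natCast_add_div_factorial hc0]
      calc _ ≤ Real.Gamma c * Ring.multichoose c (m - k) * (C * Ring.multichoose e k) :=
            mul_le_mul_of_nonneg_left (hle k) (mul_pos hGc (multichoose_pos hc0 _)).le
        _ = _ := by ring
    have hexch : Real.Gamma (m + s) / Real.Gamma (m + (s + c)) * Ring.multichoose (c + e) m ≤
        Real.Gamma e / Real.Gamma (c + e) * Ring.multichoose e m := by
      have h := Gamma_add_mul_Gamma_le (x := m + e) (y := m + s) (c := c) (by positivity)
        (by linarith) hc0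
      have h1 := Gamma_natCast_add_div_factorial (add_pos hc0 he) m
      have h2 := Gamma_natCast_add_div_factorial he m
      have hf : (0 : ℝ) < m.factorial := by positivity
      rw [div_eq_iff hf.ne'] at h1 h2
      rw [add_assoc, add_assoc, add_comm e c, h1, h2] at h
      rw [div_mul_eq_mul_div, div_mul_eq_mul_div, div_le_div_iff₀ hGsc hGce]
      refine le_of_mul_le_mul_right ?_ hf
      linarith
    unfold gammaCoeff
    rw [← hs, ← hc, hsc]
    calc _ ≤ Real.Gamma (m + s) / Real.Gamma (m + (s + c)) *
          (Real.Gamma c * C * Ring.multichoose (c + e) m) :=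
          mul_le_mul_of_nonneg_left hsum (by positivity)
      _ = Real.Gamma c * C * (Real.Gamma (m + s) / Real.Gamma (m + (s + c)) *
          Ring.multichoose (c + e) m) := by ring
      _ ≤ Real.Gamma c * C * (Real.Gamma e / Real.Gamma (c + e) * Ring.multichoose e m) :=
          mul_le_mul_of_nonneg_left hexch (by positivity)
      _ = _ := by ring

theorem succ_mul_multichoose_succ_eq {e : ℝ} (he : 0 < e) (m : ℕ) :
    ((m : ℝ) + 1) * Ring.multichoose e (m + 1) = e * Ring.multichoose (e + 1) m := by
  have h1 := Gamma_natCast_add_div_factorial he (m + 1)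
  have h2 := Gamma_natCast_add_div_factorial (show 0 < e + 1 by positivity) m
  have hG := Real.Gamma_pos_of_pos he
  rw [Real.Gamma_add_one he.ne', add_comm e 1, ← add_assoc] at h2
  rw [Nat.factorial_succ] at h1
  push_cast at h1
  rw [div_eq_iff (by positivity)] at h1 h2
  rw [h1, add_comm 1 e] at h2
  have hf : (0 : ℝ) < m.factorial := by positivity
  apply mul_left_cancel₀ (mul_pos hG hf).ne'
  linarith

/-- Growth of a power series with nonnegative coefficients dominated by `Ring.multichoose e`,
and of its derivative. -/
theorem tsum_bounds_of_le_multichoose {d : ℕ → ℝ} (hd : ∀ m, 0 ≤ d m) {e C : ℝ} (he : 0 < e)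
    (hle : ∀ m, d m ≤ C * Ring.multichoose e m) {y : ℝ} (hy : y ∈ Ioo (0 : ℝ) 1) :
    d 0 ≤ ∑' m, d m * (1 - y) ^ m ∧ ∑' m, d m * (1 - y) ^ m ≤ C * y ^ (-e) ∧
      0 ≤ ∑' m : ℕ, ((m : ℝ) + 1) * d (m + 1) * (1 - y) ^ m ∧
      y * ∑' m : ℕ, ((m : ℝ) + 1) * d (m + 1) * (1 - y) ^ m ≤ C * e * y ^ (-e) := by
  have hy1 : 0 ≤ 1 - y := by linarith [hy.2]
  have h0 := (hasSum_multichoose_mul_pow e hy).mul_left C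
  have h1 := (hasSum_multichoose_mul_pow (e + 1) hy).mul_left (C * e)
  have hle0 : ∀ m : ℕ, d m * (1 - y) ^ m ≤ C * (Ring.multichoose e m * (1 - y) ^ m) := fun m ↦ by
    rw [← mul_assoc]
    exact mul_le_mul_of_nonneg_right (hle m) (by positivity)
  have hle1 : ∀ m : ℕ, ((m : ℝ) + 1) * d (m + 1) * (1 - y) ^ m ≤
      C * e * (Ring.multichoose (e + 1) m * (1 - y) ^ m) := fun m ↦ by
    rw [← mul_assoc, mul_assoc C, ← succ_mul_multichoose_succ_eq he]
    refine mul_le_mul_of_nonneg_right ?_ (by positivity)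
    have := mul_le_mul_of_nonneg_left (hle (m + 1)) (show (0 : ℝ) ≤ (m : ℝ) + 1 by positivity)
    linarith
  have hn0 : ∀ m : ℕ, 0 ≤ d m * (1 - y) ^ m := fun m ↦ mul_nonneg (hd m) (by positivity)
  have hn1 : ∀ m : ℕ, 0 ≤ ((m : ℝ) + 1) * d (m + 1) * (1 - y) ^ m := fun m ↦
    mul_nonneg (mul_nonneg (by positivity) (hd _)) (by positivity)
  have hs0 := Summable.of_nonneg_of_le hn0 hle0 h0.summable
  have hs1 := Summable.of_nonneg_of_le hn1 hle1 h1.summable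
  refine ⟨?_, hasSum_le hle0 hs0.hasSum h0, tsum_nonneg hn1, ?_⟩
  · simpa using hs0.le_tsum 0 (fun m _ ↦ hn0 m)
  · have h := mul_le_mul_of_nonneg_left (hasSum_le hle1 hs1.hasSum h1) hy.1.le
    refine h.trans_eq ?_
    rw [show -(e + 1) = -e - 1 by ring, Real.rpow_sub_one hy.1.ne']
    have := hy.1.ne'
    field_simp

theorem lintegral_beta_lt_top {u v : ℝ} (hu : 0 < u) (hv : 0 < v) (K : ℝ) :
    ∫⁻ y in Ioo (0 : ℝ) 1, ENNReal.ofReal (K * (y ^ (u - 1) * (1 - y) ^ (v - 1))) < ⊤ := by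
  have hb := ProbabilityTheory.beta_pos hu hv
  have h := ProbabilityTheory.lintegral_betaPDF_eq_one hu hv
  rw [ProbabilityTheory.lintegral_betaPDF] at h
  calc _ ≤ ∫⁻ y in Ioo (0 : ℝ) 1, ENNReal.ofReal (|K| * ProbabilityTheory.beta u v) *
        ENNReal.ofReal (1 / ProbabilityTheory.beta u v * y ^ (u - 1) * (1 - y) ^ (v - 1)) := by
        refine setLIntegral_mono' measurableSet_Ioo fun y hy ↦ ?_
        rw [← ENNReal.ofReal_mul (by positivity)]
        refine ENNReal.ofReal_le_ofReal ?_
        have h0 : 0 ≤ y ^ (u - 1) * (1 - y) ^ (v - 1) :=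
          mul_nonneg (Real.rpow_nonneg hy.1.le _) (Real.rpow_nonneg (by linarith [hy.2]) _)
        refine (mul_le_mul_of_nonneg_right (le_abs_self K) h0).trans_eq ?_
        field_simp
    _ < ⊤ := by
        rw [lintegral_const_mul' _ _ ENNReal.ofReal_ne_top, h, mul_one]
        exact ENNReal.ofReal_lt_top

/-- Pointwise domination of `w * G * (A y / (1 - y) + T / G) ^ 2` by a Beta density kernel. -/
theorem weight_mul_sq_le {a p A e c K G T y : ℝ} (hy : y ∈ Ioo (0 : ℝ) 1) (he : 0 < e) (hc : 0 < c)
    (hcG : c ≤ G) (hG : G ≤ K * y ^ (-e)) (hT0 : 0 ≤ T) (hT : T ≤ K * y ^ (-e)) :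
    y ^ (a - 1) * (1 - y) ^ p * G * ((A * (y / (1 - y)) + T / G) ^ 2) ≤
      (2 * A ^ 2 * K + 2 * K ^ 2 / c) * (y ^ ((a - 2 * e) - 1) * (1 - y) ^ ((p - 1) - 1)) := by
  obtain ⟨hy0, hy1⟩ := hy
  have hz0 : 0 < 1 - y := by linarith
  have hG0 : 0 < G := hc.trans_le hcG
  have hE : 1 ≤ y ^ (-e) := Real.one_le_rpow_of_pos_of_le_one_of_nonpos hy0 hy1.le (by linarith)
  have hy' : y ^ (a - 1) = y ^ ((a - 2 * e) - 1) * (y ^ (e)) ^ 2 := by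
    rw [← Real.rpow_natCast, ← Real.rpow_mul hy0.le, ← Real.rpow_add hy0]
    congr 1; push_cast; ring
  have hz' : (1 - y) ^ p = (1 - y) ^ ((p - 1) - 1) * (1 - y) ^ 2 := by
    rw [← Real.rpow_natCast, ← Real.rpow_add hz0]
    congr 1; push_cast; ring
  have hK : 0 < K := by
    by_contra! h
    nlinarith
  have hF : 0 < y ^ e := Real.rpow_pos_of_pos hy0 e
  have hFE : y ^ e * y ^ (-e) = 1 := by rw [← Real.rpow_add hy0]; simp
  have hF1 : y ^ e ≤ 1 := by nlinarith
  have h1 : (1 - y) ^ 2 * (A * (y / (1 - y)) + T / G) ^ 2 ≤ 2 * A ^ 2 + 2 * T ^ 2 / G ^ 2 := by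
    have e1 : (1 - y) ^ 2 * (A * (y / (1 - y)) + T / G) ^ 2 =
        (A * y + (1 - y) * (T / G)) ^ 2 := by field_simp
    have hq : 0 ≤ T / G := by positivity
    have h3 : (A * y) ^ 2 ≤ A ^ 2 := by
      rw [mul_pow]; exact mul_le_of_le_one_right (sq_nonneg A) (by nlinarith)
    have h4 : ((1 - y) * (T / G)) ^ 2 ≤ (T / G) ^ 2 := by
      rw [mul_pow]; exact mul_le_of_le_one_left (sq_nonneg _) (by nlinarith)
    have h5 : 2 * T ^ 2 / G ^ 2 = 2 * (T / G) ^ 2 := by rw [div_pow]; ring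
    rw [e1, h5]
    nlinarith [sq_nonneg (A * y - (1 - y) * (T / G))]
  have hFG : y ^ e * G ≤ K := by
    calc _ ≤ y ^ e * (K * y ^ (-e)) := mul_le_mul_of_nonneg_left hG hF.le
      _ = K := by linear_combination K * hFE
  have hFT : y ^ e * T ≤ K := by
    calc _ ≤ y ^ e * (K * y ^ (-e)) := mul_le_mul_of_nonneg_left hT hF.le
      _ = K := by linear_combination K * hFE
  have h2 : (y ^ e) ^ 2 * G * (2 * A ^ 2 + 2 * T ^ 2 / G ^ 2) ≤
      2 * A ^ 2 * K + 2 * K ^ 2 / c := by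
    have e2 : (y ^ e) ^ 2 * G * (2 * A ^ 2 + 2 * T ^ 2 / G ^ 2) =
        2 * A ^ 2 * (y ^ e * (y ^ e * G)) + 2 * (y ^ e * T) ^ 2 / G := by field_simp
    rw [e2]
    have h6 : y ^ e * (y ^ e * G) ≤ K := by
      have : 0 ≤ y ^ e * G := by positivity
      nlinarith
    have h7 : 0 ≤ y ^ e * T := by positivity
    gcongr
  have hW : 0 ≤ y ^ ((a - 2 * e) - 1) * (1 - y) ^ ((p - 1) - 1) := by positivity
  calc _ = (y ^ ((a - 2 * e) - 1) * (1 - y) ^ ((p - 1) - 1)) * ((y ^ e) ^ 2 * G *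
        ((1 - y) ^ 2 * (A * (y / (1 - y)) + T / G) ^ 2)) := by rw [hy', hz']; ring
    _ ≤ (y ^ ((a - 2 * e) - 1) * (1 - y) ^ ((p - 1) - 1)) * ((y ^ e) ^ 2 * G *
        (2 * A ^ 2 + 2 * T ^ 2 / G ^ 2)) := by gcongr
    _ ≤ (y ^ ((a - 2 * e) - 1) * (1 - y) ^ ((p - 1) - 1)) *
        (2 * A ^ 2 * K + 2 * K ^ 2 / c) := by gcongr
    _ = _ := mul_comm _ _

/-- For `n ≥ 6` the UMVUE `u₀(Y)` of the shape parameter has finite second moment: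
`∫₀¹ y^{α−1}(1−y)^{(n−3)/2} G(y) u₀(y)² dy < ∞`, where
`u₀(y) = ((n−3)/2) y/(1−y) + y (Σ_{m≥1} m d_m (1−y)^{m−1}) / G(y)`. -/
theorem umvue_shape_finite_variance (n : ℕ) (hn : 6 ≤ n) (a : ℝ) (ha : 0 < a) :
    ∫⁻ y in Ioo (0:ℝ) 1,
      ENNReal.ofReal (y ^ (a - 1) * (1 - y) ^ (((n : ℝ) - 3) / 2) * Gfun n y *
        ((((n : ℝ) - 3) / 2 * (y / (1 - y)) +
          y * (∑' m : ℕ, ((m : ℝ) + 1) * dCoeff n (m + 1) * (1 - y) ^ m) / Gfun n y) ^ 2))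
      < ⊤ := by
  have hn0 : 0 < n := by omega
  have hn' : (6 : ℝ) ≤ n := by exact_mod_cast hn
  obtain ⟨e, he, hen, hea⟩ : ∃ e : ℝ, 0 < e ∧ e ≤ 1 / n ∧ e ≤ a / 4 :=
    ⟨min (1 / n) (a / 4), by positivity, min_le_left _ _, min_le_right _ _⟩
  have hidx : n - 1 = (n - 2) + 1 := by omega
  obtain ⟨C, hC, hle⟩ := exists_gammaCoeff_le hn0 he hen (n - 2)
  have hle' : ∀ m, dCoeff n m ≤ C * Ring.multichoose e m := by
    intro m; rw [dCoeff, hidx]; exact hle m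
  have hd : ∀ m, 0 ≤ dCoeff n m := gammaCoeff_nonneg hn0 _
  have hd0 : 0 < dCoeff n 0 := by rw [dCoeff, hidx]; exact gammaCoeff_zero_pos hn0 _
  have he1 : e ≤ 1 := hen.trans (by rw [div_le_one (by positivity)]; linarith)
  refine lt_of_le_of_lt (setLIntegral_mono' measurableSet_Ioo fun y hy ↦
    ENNReal.ofReal_le_ofReal ?_) (lintegral_beta_lt_top (u := a - 2 * e)
      (v := ((n : ℝ) - 3) / 2 - 1) (by linarith) (by linarith)
      (2 * (((n : ℝ) - 3) / 2) ^ 2 * C + 2 * C ^ 2 / dCoeff n 0))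
  obtain ⟨h1, h2, h3, h4⟩ := tsum_bounds_of_le_multichoose hd he hle' hy
  have hyE : 0 ≤ y ^ (-e) := Real.rpow_nonneg hy.1.le _
  exact weight_mul_sq_le hy he hd0 h1 h2 (mul_nonneg hy.1.le h3) (h4.trans
    (mul_le_mul_of_nonneg_right (mul_le_of_le_one_right hC.le he1) hyE))
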